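/- arXiv:2305.10313 — 6 statements merged into one kernel-verified Lean document; each statement's English description precedes it below -/
import Mathlib

section
/- Let n ≥ 1, let μ_k ∈ ℝ and σ_k > 0 for k = 1,…,n with the pairs (μ_k, σ_k) pairwise distinct, and let γ_1,…,γ_n ∈ ℝ be not all zero. Define the Gaussian mixture f(x) = Σ_{k=1}^n γ_k exp(−(x−μ_k)²/(2σ_k²)). Then the zero set {x ∈ ℝ : f(x) = 0} is finite. -/
open Filter Topology

/-- A quadratic without constant term tends to `-∞` at `+∞` when its coefficients, leading one
first, are lexicographically negative. -/
theorem tendsto_quadratic_atTop_atBot {a b : ℝ} (h : a < 0 ∨ a = 0 ∧ b < 0) :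
    Tendsto (fun x : ℝ => a * x ^ 2 + b * x) atTop atBot := by
  rcases h with ha | ⟨rfl, hb⟩
  · have h₁ : Tendsto (fun x : ℝ => a * x + b) atTop atBot :=
      tendsto_atBot_add_const_right _ _ (tendsto_id.const_mul_atTop_of_neg ha)
    exact (tendsto_id.atTop_mul_atBot₀ h₁).congr fun x => by simp only [id]; ring
  · exact (tendsto_id.const_mul_atTop_of_neg hb).congr fun x => by simp

/-- A nontrivial linear combination of exponentials of distinct quadratics without constant term
has no zeros near `+∞`. -/
theorem eventually_atTop_sum_mul_exp_quadratic_ne_zero {ι : Type*} [Fintype ι] (a b c : ι → ℝ)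
    (hab : Function.Injective fun k => (a k, b k)) (hc : ∃ k, c k ≠ 0) :
    ∀ᶠ x : ℝ in atTop, ∑ k, c k * Real.exp (a k * x ^ 2 + b k * x) ≠ 0 := by
  classical
  obtain ⟨m, hm, hmax⟩ := (Finset.univ.filter fun k => c k ≠ 0).exists_max_image
    (fun k => toLex (a k, b k)) (by simpa [Finset.Nonempty] using hc)
  simp only [Finset.mem_filter, Finset.mem_univ, true_and] at hm hmax
  have hlim : Tendsto (fun x : ℝ => ∑ k, c k * Real.exp ((a k - a m) * x ^ 2 + (b k - b m) * x))
      atTop (𝓝 (∑ k, if k = m then c k else 0)) := by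
    refine tendsto_finsetSum _ fun k _ => ?_
    by_cases hk : k = m
    · subst hk
      simp
    by_cases hck : c k = 0
    · simp [hck]
    have hlt : toLex (a k, b k) < toLex (a m, b m) :=
      (hmax k hck).lt_of_ne fun h => hk (hab (toLex.injective h))
    rw [Prod.Lex.toLex_lt_toLex] at hlt
    have hexp := Real.tendsto_exp_atBot.comp (tendsto_quadratic_atTop_atBot
      (a := a k - a m) (b := b k - b m) (by simpa [sub_eq_zero] using hlt))
    simpa [hk] using hexp.const_mul (c k)
  rw [Finset.sum_ite_eq' Finset.univ m c, if_pos (Finset.mem_univ m)] at hlim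
  filter_upwards [hlim.eventually_ne hm] with x hx hzero
  apply hx
  calc ∑ k, c k * Real.exp ((a k - a m) * x ^ 2 + (b k - b m) * x)
      = (∑ k, c k * Real.exp (a k * x ^ 2 + b k * x)) * Real.exp (-(a m * x ^ 2 + b m * x)) := by
        rw [Finset.sum_mul]
        refine Finset.sum_congr rfl fun k _ => ?_
        rw [mul_assoc, ← Real.exp_add]
        ring_nf
    _ = 0 := by rw [hzero, zero_mul]

/-- A nontrivial linear combination of exponentials of distinct quadratics without constant term
has no zeros near `-∞`. -/
theorem eventually_atBot_sum_mul_exp_quadratic_ne_zero {ι : Type*} [Fintype ι] (a b c : ι → ℝ)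
    (hab : Function.Injective fun k => (a k, b k)) (hc : ∃ k, c k ≠ 0) :
    ∀ᶠ x : ℝ in atBot, ∑ k, c k * Real.exp (a k * x ^ 2 + b k * x) ≠ 0 := by
  have h := eventually_atTop_sum_mul_exp_quadratic_ne_zero a (fun k => -b k) c
    (fun i j hij => hab (by simpa using hij)) hc
  simpa using tendsto_neg_atBot_atTop.eventually h

/-- A real analytic function on the line without zeros near `±∞` has finitely many zeros. -/
theorem AnalyticOnNhd.finite_zeros_of_eventually_ne_zero {f : ℝ → ℝ}
    (hf : AnalyticOnNhd ℝ f Set.univ) (hbot : ∀ᶠ x in atBot, f x ≠ 0)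
    (htop : ∀ᶠ x in atTop, f x ≠ 0) : {x | f x = 0}.Finite := by
  by_contra hinf
  obtain ⟨l, hl⟩ := eventually_atBot.mp hbot
  obtain ⟨u, hu⟩ := eventually_atTop.mp htop
  have hsub : {x | f x = 0} ⊆ Set.Icc l u := fun x hx =>
    ⟨le_of_not_ge fun h => hl x h hx, le_of_not_ge fun h => hu x h hx⟩
  obtain ⟨x, -, hx⟩ := Set.Infinite.exists_accPt_of_subset_isCompact hinf isCompact_Icc hsub
  exact hu u le_rfl (hf.eqOn_zero_of_preconnected_of_frequently_eq_zero isPreconnected_univ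
    (Set.mem_univ x) (accPt_iff_frequently_nhdsNE.mp hx) (Set.mem_univ u))

/-- A nontrivial finite Gaussian mixture with arbitrary real
coefficients has a finite zero set. -/
theorem gaussian_mixture_zero_set_finite
    (n : ℕ) (hn : 1 ≤ n) (μ σ γ : Fin n → ℝ)
    (hσ : ∀ k, 0 < σ k)
    (hdist : Function.Injective fun k => (μ k, σ k))
    (hγ : ∃ k, γ k ≠ 0) :
    {x : ℝ | ∑ k, γ k * Real.exp (-(x - μ k) ^ 2 / (2 * σ k ^ 2)) = 0}.Finite := by
  set a : Fin n → ℝ := fun k => -(2 * σ k ^ 2)⁻¹ with ha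
  set b : Fin n → ℝ := fun k => μ k / σ k ^ 2 with hb
  set c : Fin n → ℝ := fun k => γ k * Real.exp (-μ k ^ 2 / (2 * σ k ^ 2)) with hc
  have hab : Function.Injective fun k => (a k, b k) := by
    intro i j hij
    obtain ⟨hai, hbi⟩ := Prod.mk.inj hij
    have hsq : σ i ^ 2 = σ j ^ 2 := by simpa [ha] using hai
    have hμ : μ i = μ j := by
      simp only [hb, hsq] at hbi
      exact (div_left_inj' (pow_pos (hσ j) 2).ne').mp hbi
    exact hdist (Prod.ext hμ ((pow_left_inj₀ (hσ i).le (hσ j).le two_ne_zero).mp hsq))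
  have hc₀ : ∃ k, c k ≠ 0 := hγ.imp fun k hk => mul_ne_zero hk (Real.exp_ne_zero _)
  have hfun (x : ℝ) : ∑ k, γ k * Real.exp (-(x - μ k) ^ 2 / (2 * σ k ^ 2)) =
      ∑ k, c k * Real.exp (a k * x ^ 2 + b k * x) := by
    refine Finset.sum_congr rfl fun k _ => ?_
    have := (hσ k).ne'
    simp only [ha, hb, hc]
    rw [mul_assoc, ← Real.exp_add]
    congr 2
    field_simp
    ring
  simp only [hfun]
  refine AnalyticOnNhd.finite_zeros_of_eventually_ne_zero (fun x _ => by fun_prop)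
    (eventually_atBot_sum_mul_exp_quadratic_ne_zero a b c hab hc₀)
    (eventually_atTop_sum_mul_exp_quadratic_ne_zero a b c hab hc₀)
end

section
/- With the notation below, for all indices 2 ≤ j < k ≤ n and all x ∈ ℝ the following identity of functions holds: Q^{j}_{1,…,j,k}(x) · Q^{j−2}_{1,…,j−1}(x) = Q^{j−1}_{1,…,j}(x) · [ (φ_k(x) − φ_j(x)) · Q^{j−1}_{1,…,j−1,k}(x) + (d/dx) Q^{j−1}_{1,…,j−1,k}(x) ] − Q^{j−1}_{1,…,j−1,k}(x) · (d/dx) Q^{j−1}_{1,…,j}(x). -/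
open Matrix

/-- Jacobi's formula for the derivative of a determinant. -/
theorem Matrix.hasDerivAt_det {ι : Type*} [Fintype ι] [DecidableEq ι] {M : ℝ → Matrix ι ι ℝ}
    {M' : Matrix ι ι ℝ} {x : ℝ} (h : ∀ r c, HasDerivAt (fun y => M y r c) (M' r c) x) :
    HasDerivAt (fun y => (M y).det) ((M x).adjugate * M').trace x := by
  have key : ((M x).adjugate * M').trace = ∑ τ : Equiv.Perm ι, ((Equiv.Perm.sign τ : ℤ) : ℝ) *
      ∑ c, (∏ d ∈ Finset.univ.erase c, M x (τ d) d) • M' (τ c) c := by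
    simp_rw [Finset.mul_sum]
    rw [Finset.sum_comm, trace]
    refine Finset.sum_congr rfl fun c _ => ?_
    have hc : ((M x).adjugate * M').diag c = ((M x).updateCol c fun r => M' r c).det := by
      rw [← cramer_apply, cramer_eq_adjugate_mulVec]
      rfl
    rw [hc, det_apply']
    refine Finset.sum_congr rfl fun τ _ => ?_
    rw [← Finset.prod_erase_mul _ _ (Finset.mem_univ c), updateCol_self, smul_eq_mul]
    congr 2
    exact Finset.prod_congr rfl fun d hd => updateCol_ne (Finset.ne_of_mem_erase hd)
  rw [key]
  simp_rw [det_apply']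
  refine HasDerivAt.fun_sum fun τ _ => HasDerivAt.const_mul _ ?_
  exact HasDerivAt.fun_finsetProd fun c _ => h (τ c) c

theorem Matrix.trace_mul_adjugate {ι R : Type*} [Fintype ι] [DecidableEq ι] [CommRing R]
    (N M : Matrix ι ι R) : (N * M.adjugate).trace = ∑ r, (M.updateRow r (N r)).det := by
  refine Finset.sum_congr rfl fun r _ => ?_
  rw [← cramer_transpose_apply, cramer_eq_adjugate_mulVec, ← adjugate_transpose, mulVec_transpose]
  rfl

/-- If `(p r c)' = p (r + 1) c - φ c * p r c`, then differentiating the determinant of `p r c`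
advances its last row by one and subtracts `∑ c, φ c` times the determinant. -/
theorem Matrix.hasDerivAt_det_of_shift {m : ℕ} {p : ℕ → Fin (m + 1) → ℝ → ℝ}
    {φ : Fin (m + 1) → ℝ} {x : ℝ}
    (h : ∀ r c, HasDerivAt (p r c) (p (r + 1) c x - φ c * p r c x) x) :
    HasDerivAt (fun y => (of fun r c : Fin (m + 1) => p r c y).det)
      ((of fun r c : Fin (m + 1) => p ((Fin.last m).castSucc.succAbove r) c x).det -
        (∑ c, φ c) * (of fun r c : Fin (m + 1) => p r c x).det) x := by
  set M : Matrix (Fin (m + 1)) (Fin (m + 1)) ℝ := of fun r c => p r c x with hM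
  set N : Matrix (Fin (m + 1)) (Fin (m + 1)) ℝ := of fun r c => p (r + 1) c x with hN
  have hd := hasDerivAt_det (M := fun y => of fun r c : Fin (m + 1) => p r c y)
    (M' := N - M * diagonal φ) (x := x) (fun r c => by
      convert! h r c using 1
      simp [hM, hN, mul_comm])
  have hrow : ∑ r, (M.updateRow r (N r)).det =
      (of fun r c : Fin (m + 1) => p ((Fin.last m).castSucc.succAbove r) c x).det := by
    rw [Fin.sum_univ_castSucc, Finset.sum_eq_zero, zero_add]
    · congr 1
      ext r c
      refine Fin.lastCases ?_ (fun r => ?_) r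
      · simp [hN]
      · rw [updateRow_ne (Fin.castSucc_lt_last r).ne]
        simp [hM, Fin.succAbove, Fin.lt_def]
    · intro r _
      refine det_zero_of_row_eq (i := r.castSucc) (j := r.succ) Fin.castSucc_lt_succ.ne ?_
      rw [updateRow_self, updateRow_ne Fin.castSucc_lt_succ.ne']
      ext c
      simp [hM, hN]
  convert! hd using 1
  rw [mul_sub, trace_sub, ← hM, ← mul_assoc, adjugate_mul, smul_mul, one_mul, trace_smul,
    trace_diagonal, trace_mul_comm, trace_mul_adjugate, hrow, smul_eq_mul, mul_comm]

theorem Matrix.det_mul_det_toBlocks₁₁_of_det_ne_zero {ι R : Type*} [Fintype ι] [DecidableEq ι]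
    [CommRing R] [IsDomain R] (A : Matrix (ι ⊕ Fin 2) (ι ⊕ Fin 2) R) (hA : A.det ≠ 0) :
    A.det * A.toBlocks₁₁.det = A.adjugate.toBlocks₂₂.det := by
  have h : A * fromBlocks 1 A.adjugate.toBlocks₁₂ 0 A.adjugate.toBlocks₂₂ =
      fromBlocks A.toBlocks₁₁ 0 A.toBlocks₂₁ (A.det • 1) := by
    have h1 := mul_adjugate A
    rw [← fromBlocks_one, fromBlocks_smul] at h1
    nth_rw 1 [← fromBlocks_toBlocks A, ← fromBlocks_toBlocks A.adjugate] at h1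
    nth_rw 1 [← fromBlocks_toBlocks A]
    rw [fromBlocks_multiply, fromBlocks_inj] at h1 ⊢
    simp [h1.2.1, h1.2.2.2]
  have h2 := congrArg det h
  rw [det_mul, det_fromBlocks_zero₂₁, det_fromBlocks_zero₁₂, det_smul, det_one, det_one,
    Fintype.card_fin, one_mul, mul_one] at h2
  refine mul_left_cancel₀ hA ?_
  rw [h2]
  ring

/-- Jacobi's identity for the complementary `2 × 2` minor of the adjugate. -/
theorem Matrix.det_mul_det_toBlocks₁₁ {ι R : Type*} [Fintype ι] [DecidableEq ι]
    [CommRing R] (A : Matrix (ι ⊕ Fin 2) (ι ⊕ Fin 2) R) :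
    A.det * A.toBlocks₁₁.det = A.adjugate.toBlocks₂₂.det := by
  have h := congrArg (MvPolynomial.eval₂Hom (Int.castRingHom R) fun p : (ι ⊕ Fin 2) × (ι ⊕ Fin 2) => A p.1 p.2)
    (det_mul_det_toBlocks₁₁_of_det_ne_zero _ (det_mvPolynomialX_ne_zero (ι ⊕ Fin 2) ℤ))
  set f := MvPolynomial.eval₂Hom (Int.castRingHom R) fun p : (ι ⊕ Fin 2) × (ι ⊕ Fin 2) => A p.1 p.2
  set X := mvPolynomialX (ι ⊕ Fin 2) (ι ⊕ Fin 2) ℤ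
  have hX : f.mapMatrix X = A := by
    ext r c
    simp [f, X]
  rw [map_mul, RingHom.map_det, RingHom.map_det, RingHom.map_det, hX] at h
  have h1 : f.mapMatrix X.toBlocks₁₁ = A.toBlocks₁₁ := by rw [← hX]; rfl
  have h2 : f.mapMatrix X.adjugate.toBlocks₂₂ = A.adjugate.toBlocks₂₂ := by
    rw [← hX, ← RingHom.map_adjugate]; rfl
  rwa [h1, h2] at h

/-- The Desnanot–Jacobi identity for the last two rows and columns. -/
theorem Matrix.desnanot_jacobi {R : Type*} [CommRing R] {m : ℕ}
    (A : Matrix (Fin (m + 2)) (Fin (m + 2)) R) :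
    A.det * (A.submatrix (fun i : Fin m => i.castSucc.castSucc) fun i => i.castSucc.castSucc).det =
      (A.submatrix Fin.castSucc Fin.castSucc).det *
          (A.submatrix (Fin.last m).castSucc.succAbove (Fin.last m).castSucc.succAbove).det -
        (A.submatrix (Fin.last m).castSucc.succAbove Fin.castSucc).det *
          (A.submatrix Fin.castSucc (Fin.last m).castSucc.succAbove).det := by
  have h := det_mul_det_toBlocks₁₁ (A.submatrix (finSumFinEquiv (m := m) (n := 2)) finSumFinEquiv)
  rw [det_submatrix_equiv_self, adjugate_submatrix_equiv_self, det_fin_two] at h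
  have e0 : finSumFinEquiv (m := m) (n := 2) (Sum.inr 0) = (Fin.last m).castSucc := by
    ext; simp
  have e1 : finSumFinEquiv (m := m) (n := 2) (Sum.inr 1) = Fin.last (m + 1) := by
    ext; simp
  simp only [toBlocks₂₂, of_apply, submatrix_apply, e0, e1, adjugate_fin_succ_eq_det_submatrix,
    Fin.succAbove_last, Fin.val_last, Fin.val_castSucc] at h
  refine Eq.trans h ?_
  have s : ((-1 : R) ^ m) ^ 2 = 1 := by rw [← pow_mul, mul_comm, pow_mul]; simp
  simp only [pow_add, pow_one]
  linear_combination ((A.submatrix Fin.castSucc Fin.castSucc).det *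
      (A.submatrix (Fin.last m).castSucc.succAbove (Fin.last m).castSucc.succAbove).det -
        (A.submatrix (Fin.last m).castSucc.succAbove Fin.castSucc).det *
          (A.submatrix Fin.castSucc (Fin.last m).castSucc.succAbove).det) *
    (((-1 : R) ^ m) ^ 2 + 1) * s

/-- The generalized Hermite polynomials satisfy `P_m' = P_{m+1} - φ P_m`. -/
theorem hasDerivAt_exp_mul_iteratedDeriv_gaussian (μ σ : ℝ) (m : ℕ) (x : ℝ) :
    let p : ℕ → ℝ → ℝ := fun m x => Real.exp ((x - μ) ^ 2 / (2 * σ ^ 2)) *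
      iteratedDeriv m (fun y => Real.exp (-((y - μ) ^ 2 / (2 * σ ^ 2)))) x
    HasDerivAt (p m) (p (m + 1) x - (μ - x) / σ ^ 2 * p m x) x := by
  intro p
  have hq : HasDerivAt (fun y : ℝ => (y - μ) ^ 2 / (2 * σ ^ 2)) (-((μ - x) / σ ^ 2)) x := by
    convert! (((hasDerivAt_id x).sub_const μ).pow 2).div_const (2 * σ ^ 2) using 1
    rw [← neg_div, ← mul_div_mul_left (-(μ - x)) (σ ^ 2) (two_ne_zero)]
    simp
  have hg : ContDiff ℝ (m + 1 : ℕ) fun y : ℝ => Real.exp (-((y - μ) ^ 2 / (2 * σ ^ 2))) := by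
    fun_prop
  have hd := (hg.differentiable_iteratedDeriv m (by exact_mod_cast Nat.lt_succ_self m) x).hasDerivAt
  rw [← iteratedDeriv_succ] at hd
  convert! hq.exp.mul hd using 1
  simp only [p]
  ring

/-- The recursive determinant identity for the polynomials
`Q^{j}_{i₁,…,i_{j+1}}` built from the generalized Hermite polynomials
`P_{m,k}(x) = e^{q_k(x)} (d^m/dx^m) e^{−q_k(x)}`, `q_k(x) = (x−μ_k)²/(2σ_k²)`:
for `2 ≤ j < k ≤ n`,
`Q^{j}_{1,…,j,k} · Q^{j−2}_{1,…,j−1}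
  = Q^{j−1}_{1,…,j} · [(φ_k − φ_j)·Q^{j−1}_{1,…,j−1,k} + D Q^{j−1}_{1,…,j−1,k}]
    − Q^{j−1}_{1,…,j−1,k} · D Q^{j−1}_{1,…,j}`,
where `φ_k(x) = (μ_k − x)/σ_k²`. -/
theorem Q_determinant_recursion
    (n : ℕ) (μ σ : ℕ → ℝ)
    (hσ : ∀ k, 1 ≤ k → k ≤ n → 0 < σ k)
    (hdist : ∀ k l, 1 ≤ k → k ≤ n → 1 ≤ l → l ≤ n → μ k = μ l → σ k = σ l → k = l)
    (P : ℕ → ℕ → ℝ → ℝ)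
    (hP : ∀ (m k : ℕ) (x : ℝ), P m k x =
      Real.exp ((x - μ k) ^ 2 / (2 * σ k ^ 2)) *
        iteratedDeriv m (fun y => Real.exp (-((y - μ k) ^ 2 / (2 * σ k ^ 2)))) x)
    (Q : (j : ℕ) → (Fin j → ℕ) → ℝ → ℝ)
    (hQ : ∀ (j : ℕ) (idx : Fin j → ℕ) (x : ℝ),
      Q j idx x = Matrix.det (Matrix.of fun r c : Fin j => P (r : ℕ) (idx c) x))
    (j k : ℕ) (hj : 2 ≤ j) (hjk : j < k) (hkn : k ≤ n) (x : ℝ) :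
    Q (j + 1) (fun c => if (c : ℕ) < j then (c : ℕ) + 1 else k) x *
        Q (j - 1) (fun c => (c : ℕ) + 1) x =
      Q j (fun c => (c : ℕ) + 1) x *
          (((μ k - x) / σ k ^ 2 - (μ j - x) / σ j ^ 2) *
              Q j (fun c => if (c : ℕ) < j - 1 then (c : ℕ) + 1 else k) x +
            deriv (Q j fun c => if (c : ℕ) < j - 1 then (c : ℕ) + 1 else k) x) -
        Q j (fun c => if (c : ℕ) < j - 1 then (c : ℕ) + 1 else k) x *
          deriv (Q j fun c => (c : ℕ) + 1) x := by
  obtain ⟨m, rfl⟩ : ∃ m, j = m + 1 := ⟨j - 1, by omega⟩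
  rw [Nat.add_sub_cancel]
  have hPd (r c : ℕ) : HasDerivAt (P r c) (P (r + 1) c x - (μ c - x) / σ c ^ 2 * P r c x) x := by
    have hPc (r : ℕ) := funext (hP r c)
    rw [hPc, hPc]
    exact hasDerivAt_exp_mul_iteratedDeriv_gaussian (μ c) (σ c) r x
  have hQd (idx : Fin (m + 1) → ℕ) : deriv (Q (m + 1) idx) x =
      (of fun r c : Fin (m + 1) => P ((Fin.last m).castSucc.succAbove r) (idx c) x).det -
        (∑ c, (μ (idx c) - x) / σ (idx c) ^ 2) * Q (m + 1) idx x := by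
    rw [funext (hQ (m + 1) idx)]
    exact (hasDerivAt_det_of_shift (p := fun r c => P r (idx c)) fun r c => hPd r (idx c)).deriv
  have hA := desnanot_jacobi (of fun r c : Fin (m + 2) =>
    P r (if (c : ℕ) < m + 1 then (c : ℕ) + 1 else k) x)
  have hidx (c : Fin (m + 1)) : (if ((Fin.last m).castSucc.succAbove c : ℕ) < m + 1 then
      ((Fin.last m).castSucc.succAbove c : ℕ) + 1 else k) = if (c : ℕ) < m then (c : ℕ) + 1 else k := by
    refine Fin.lastCases ?_ (fun c => ?_) c
    · simp
    · simp [Fin.succAbove, Fin.lt_def, c.isLt.trans (Nat.lt_succ_self m)]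
  have hlt (c : Fin m) : (c : ℕ) < m + 1 := c.isLt.trans (Nat.lt_succ_self m)
  simp only [submatrix, of_apply, hidx, Fin.val_castSucc, Fin.is_lt, if_true, hlt] at hA
  rw [hQd, hQd]
  simp only [Fin.sum_univ_castSucc, Fin.val_castSucc, Fin.val_last, Fin.is_lt, if_true,
    lt_irrefl, if_false]
  simp only [hQ]
  rw [hA]
  ring
end

section
/- Let f(x) = Σ_{k=1}^n γ_k h_k(x) be a finite Gaussian mixture and, using the notation below, set W_0 ≡ 1 and W_j = W(h_1,…,h_j) for 1 ≤ j ≤ n. Let I ⊂ ℝ be an open interval on which W_i(x) ≠ 0 for all 1 ≤ i ≤ n. Define functions ψ_j on I recursively by ψ_0 = f and ψ_j(x) = (W_j(x)/W_{j−1}(x)) · (d/dx)[ (W_{j−1}/W_j)·ψ_{j−1} ](x). Then for every 1 ≤ j < n and every x ∈ I, ψ_j(x) = Σ_{k=j+1}^n γ_k · ( Q^{j}_{1,…,j,k}(x) / Q^{j−1}_{1,…,j}(x) ) · h_k(x). -/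
/-- Schur complement formula for a square matrix whose leading `j × j` block is invertible. -/
lemma Matrix.det_eq_det_mul_det_schur {j l : ℕ} (M : Matrix (Fin (j + l)) (Fin (j + l)) ℝ)
    (hA : (M.submatrix (Fin.castAdd l) (Fin.castAdd l)).det ≠ 0) :
    M.det = (M.submatrix (Fin.castAdd l) (Fin.castAdd l)).det *
      (M.submatrix (Fin.natAdd j) (Fin.natAdd j) -
        M.submatrix (Fin.natAdd j) (Fin.castAdd l) *
          (M.submatrix (Fin.castAdd l) (Fin.castAdd l))⁻¹ *
          M.submatrix (Fin.castAdd l) (Fin.natAdd j)).det := by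
  let _ : Invertible (M.submatrix (Fin.castAdd l) (Fin.castAdd l)) :=
    Matrix.invertibleOfIsUnitDet _ (isUnit_iff_ne_zero.mpr hA)
  rw [← Matrix.invOf_eq_nonsing_inv, ← Matrix.det_fromBlocks₁₁,
    ← Matrix.det_submatrix_equiv_self finSumFinEquiv M]
  congr 1
  ext (r | r) (c | c) <;> simp

/-- Sylvester's determinant identity for the `2 × 2` family of bordered leading minors. -/
lemma Matrix.det_bordered_mul_sub {j : ℕ} (M : Matrix (Fin (j + 2)) (Fin (j + 2)) ℝ)
    (hA : (M.submatrix (Fin.castAdd 2) (Fin.castAdd 2)).det ≠ 0)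
    (S : Fin 2 → Fin 2 → Matrix (Fin (j + 1)) (Fin (j + 1)) ℝ)
    (hS : ∀ i k, S i k = M.submatrix
      (Fin.snoc (α := fun _ => Fin (j + 2)) (Fin.castAdd 2) (Fin.natAdd j i))
      (Fin.snoc (α := fun _ => Fin (j + 2)) (Fin.castAdd 2) (Fin.natAdd j k))) :
    (S 1 1).det * (S 0 0).det - (S 0 1).det * (S 1 0).det =
      (M.submatrix (Fin.castAdd 2) (Fin.castAdd 2)).det * M.det := by
  have hlead : ∀ i k, (S i k).submatrix (Fin.castAdd 1) (Fin.castAdd 1) =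
      M.submatrix (Fin.castAdd 2) (Fin.castAdd 2) := by
    intro i k
    ext r c
    rw [hS]
    change M (Fin.snoc (α := fun _ => Fin (j + 2)) _ _ (Fin.castSucc r))
      (Fin.snoc (α := fun _ => Fin (j + 2)) _ _ (Fin.castSucc c)) = _
    simp
  have hborder : ∀ i k, (S i k).det = (M.submatrix (Fin.castAdd 2) (Fin.castAdd 2)).det *
      (M.submatrix (Fin.natAdd j) (Fin.natAdd j) -
        M.submatrix (Fin.natAdd j) (Fin.castAdd 2) *
          (M.submatrix (Fin.castAdd 2) (Fin.castAdd 2))⁻¹ *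
          M.submatrix (Fin.castAdd 2) (Fin.natAdd j)) i k := by
    intro i k
    have hlast : ∀ a : Fin 1, Fin.natAdd j a = Fin.last j := by
      intro a; ext; simp
    have hcast : ∀ a : Fin j, Fin.castAdd 1 a = Fin.castSucc a := fun _ => rfl
    rw [Matrix.det_eq_det_mul_det_schur (S i k) (by rw [hlead]; exact hA), hlead,
      Matrix.det_fin_one]
    simp only [Matrix.sub_apply, Matrix.mul_apply, Matrix.submatrix_apply, hlast, hcast, hS,
      Fin.snoc_last, Fin.snoc_castSucc]
  rw [Matrix.det_eq_det_mul_det_schur M hA, Matrix.det_fin_two]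
  simp only [hborder]
  ring

/-- The derivative of a determinant is the sum of the determinants obtained by differentiating
one row at a time. -/
lemma Matrix.hasDerivAt_det_s9 {m : ℕ} {M : ℝ → Matrix (Fin m) (Fin m) ℝ}
    {M' : Matrix (Fin m) (Fin m) ℝ} {x : ℝ}
    (hM : ∀ r c, HasDerivAt (fun y => M y r c) (M' r c) x) :
    HasDerivAt (fun y => (M y).det) (∑ r, ((M x).updateRow r (M' r)).det) x := by
  have hdet : ∀ A : Matrix (Fin m) (Fin m) ℝ,
      A.det = ∑ τ : Equiv.Perm (Fin m), (Equiv.Perm.sign τ : ℝ) * ∏ i, A i (τ i) := by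
    intro A
    rw [← Matrix.det_transpose, Matrix.det_apply']
    rfl
  simp only [hdet]
  rw [Finset.sum_comm]
  refine HasDerivAt.fun_sum fun τ _ => ?_
  rw [← Finset.mul_sum]
  refine HasDerivAt.const_mul _ ?_
  refine (HasDerivAt.fun_finsetProd fun i _ => hM i (τ i)).congr_deriv ?_
  refine Finset.sum_congr rfl fun r _ => ?_
  rw [← Finset.prod_erase_mul _ _ (Finset.mem_univ r), Matrix.updateRow_self, smul_eq_mul]
  congr 1
  refine Finset.prod_congr rfl fun i hi => ?_
  rw [Matrix.updateRow_ne (Finset.ne_of_mem_erase hi)]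

/-- The derivative of a Wronskian is obtained by differentiating its last row. -/
lemma hasDerivAt_wronskian {j : ℕ} (g : Fin (j + 1) → ℝ → ℝ)
    (hg : ∀ c, ContDiff ℝ (⊤ : ℕ∞) (g c)) (x : ℝ) :
    HasDerivAt
      (fun y => (Matrix.of fun r c : Fin (j + 1) => iteratedDeriv (r : ℕ) (g c) y).det)
      (Matrix.of fun r c : Fin (j + 1) =>
        iteratedDeriv (if (r : ℕ) < j then (r : ℕ) else j + 1) (g c) x).det x := by
  have hM : ∀ r c : Fin (j + 1),
      HasDerivAt (fun y => (Matrix.of fun r c : Fin (j + 1) => iteratedDeriv (r : ℕ) (g c) y) r c)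
        ((Matrix.of fun r c : Fin (j + 1) => iteratedDeriv ((r : ℕ) + 1) (g c) x) r c) x := by
    intro r c
    simp only [Matrix.of_apply, iteratedDeriv_succ]
    exact ((hg c).differentiable_iteratedDeriv (r : ℕ)
      (by exact_mod_cast ENat.natCast_lt_top _) x).hasDerivAt
  refine (Matrix.hasDerivAt_det_s9
    (M := fun y => Matrix.of fun r c : Fin (j + 1) => iteratedDeriv (r : ℕ) (g c) y)
    hM).congr_deriv ?_
  rw [Finset.sum_eq_single (Fin.last j)]
  · congr 1
    ext r c
    induction r using Fin.lastCases with
    | last => simp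
    | cast r => simp [Matrix.updateRow_apply, r.castSucc_lt_last.ne]
  · intro r _ hr
    obtain ⟨r, rfl⟩ := Fin.exists_castSucc_eq.mpr hr
    refine Matrix.det_zero_of_row_eq (i := r.castSucc) (j := r.succ)
      (Fin.castSucc_lt_succ).ne ?_
    ext c
    rw [Matrix.updateRow_self, Matrix.updateRow_ne (Fin.castSucc_lt_succ).ne']
    simp
  · simp

/-- The Wronskian of `h 1, …, h j, h k`. -/
noncomputable def borderedWronskian (h : ℕ → ℝ → ℝ) (j k : ℕ) (x : ℝ) : ℝ :=
  (Matrix.of fun r c : Fin (j + 1) =>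
    iteratedDeriv (r : ℕ) (h (if (c : ℕ) < j then (c : ℕ) + 1 else k)) x).det

/-- The Wronskian of `h 1, …, h j`. -/
noncomputable def leadingWronskian (h : ℕ → ℝ → ℝ) (j : ℕ) (x : ℝ) : ℝ :=
  (Matrix.of fun r c : Fin j => iteratedDeriv (r : ℕ) (h ((c : ℕ) + 1)) x).det

lemma borderedWronskian_self (h : ℕ → ℝ → ℝ) (j : ℕ) (x : ℝ) :
    borderedWronskian h j (j + 1) x = leadingWronskian h (j + 1) x := by
  unfold borderedWronskian leadingWronskian
  congr 1
  ext r c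
  have := c.isLt
  simp only [Matrix.of_apply]
  split_ifs with hc
  · rfl
  · rw [show (c : ℕ) = j by omega]

lemma borderedWronskian_eq_zero (h : ℕ → ℝ → ℝ) {j k : ℕ} (hk : 1 ≤ k) (hkj : k ≤ j) (x : ℝ) :
    borderedWronskian h j k x = 0 := by
  have hlt : k - 1 < j := by omega
  refine Matrix.det_zero_of_column_eq (i := ⟨k - 1, by omega⟩) (j := Fin.last j)
    (by simp [Fin.ext_iff]; omega) fun r => ?_
  simp [hlt, Nat.sub_add_cancel hk]

/-- The quotient rule for Wronskians sharing the functions `h 1, …, h j`. -/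
lemma hasDerivAt_borderedWronskian_div (h : ℕ → ℝ → ℝ)
    (hs : ∀ k, ContDiff ℝ (⊤ : ℕ∞) (h k)) (j k : ℕ) (x : ℝ)
    (h0 : leadingWronskian h j x ≠ 0) (h1 : leadingWronskian h (j + 1) x ≠ 0) :
    HasDerivAt (fun y => borderedWronskian h j k y / leadingWronskian h (j + 1) y)
      (leadingWronskian h j x * borderedWronskian h (j + 1) k x /
        leadingWronskian h (j + 1) x ^ 2) x := by
  have hd : ∀ k, HasDerivAt (borderedWronskian h j k) _ x := fun k =>
    hasDerivAt_wronskian (fun c : Fin (j + 1) => h (if (c : ℕ) < j then (c : ℕ) + 1 else k))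
      (fun c => hs _) x
  have hself : borderedWronskian h j (j + 1) = leadingWronskian h (j + 1) :=
    funext (borderedWronskian_self h j)
  have hW := hd (j + 1)
  rw [hself] at hW
  refine ((hd k).fun_div hW h1).congr_deriv ?_
  congr 1
  let M : Matrix (Fin (j + 2)) (Fin (j + 2)) ℝ := Matrix.of fun r c =>
    iteratedDeriv (r : ℕ) (h (if (c : ℕ) < j + 1 then (c : ℕ) + 1 else k)) x
  let row : Fin 2 → Fin (j + 1) → ℕ := fun i r => if (r : ℕ) < j then (r : ℕ) else j + i
  let col : Fin 2 → ℕ := fun i => if i = 0 then j + 1 else k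
  let S : Fin 2 → Fin 2 → Matrix (Fin (j + 1)) (Fin (j + 1)) ℝ := fun i l =>
    Matrix.of fun r c => iteratedDeriv (row i r)
      (h (if (c : ℕ) < j then (c : ℕ) + 1 else col l)) x
  have hlead : (M.submatrix (Fin.castAdd 2) (Fin.castAdd 2)).det = leadingWronskian h j x := by
    unfold leadingWronskian
    congr 1
    ext r c
    simp [M]
  have hS : ∀ i l, S i l = M.submatrix
      (Fin.snoc (α := fun _ => Fin (j + 2)) (Fin.castAdd 2) (Fin.natAdd j i))
      (Fin.snoc (α := fun _ => Fin (j + 2)) (Fin.castAdd 2) (Fin.natAdd j l)) := by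
    intro i l
    ext r c
    have hr : row i r =
        (Fin.snoc (α := fun _ => Fin (j + 2)) (Fin.castAdd 2) (Fin.natAdd j i) r : ℕ) := by
      induction r using Fin.lastCases <;> simp [row]
    have hc : (if (c : ℕ) < j then (c : ℕ) + 1 else col l) =
        if (Fin.snoc (α := fun _ => Fin (j + 2)) (Fin.castAdd 2) (Fin.natAdd j l) c : ℕ) < j + 1
        then (Fin.snoc (α := fun _ => Fin (j + 2)) (Fin.castAdd 2) (Fin.natAdd j l) c : ℕ) + 1
        else k := by
      induction c using Fin.lastCases with
      | last => fin_cases l <;> simp [col]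
      | cast c =>
        simp [show (c : ℕ) < j + 1 by omega]
    simp only [S, M, Matrix.of_apply, Matrix.submatrix_apply, hr, hc]
  have hrow : ∀ r, row 0 r = (r : ℕ) := by
    intro r
    have := r.isLt
    simp only [row]
    split_ifs
    · rfl
    · simp; omega
  have key := Matrix.det_bordered_mul_sub M (by rwa [hlead]) S hS
  rw [hlead] at key
  have hS0 : ∀ l, (S 0 l).det = borderedWronskian h j (col l) x := by
    intro l
    simp only [S, hrow, borderedWronskian]
  rw [hS0, hS0] at key
  simp only [col, if_true, one_ne_zero, if_false, hself] at key
  exact key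

/-- For a finite Gaussian mixture `f = Σ_{k=1}^n γ_k h_k` the
generalized Budan–Fourier sequence obtained from the Polya–Ristroph formula,
`ψ_j = (W_j/W_{j−1}) · D[(W_{j−1}/W_j)·ψ_{j−1}]`, satisfies on any open interval
where the Wronskians do not vanish:
`ψ_j = Σ_{k=j+1}^n γ_k · (Q^{j}_{1,…,j,k} / Q^{j−1}_{1,…,j}) · h_k` for `1 ≤ j < n`. -/
theorem gbf_sequence_eq_Q_quotient_form
    (n : ℕ) (μ σ γ : ℕ → ℝ)
    (hσ : ∀ k, 1 ≤ k → k ≤ n → 0 < σ k)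
    (hdist : ∀ k l, 1 ≤ k → k ≤ n → 1 ≤ l → l ≤ n → μ k = μ l → σ k = σ l → k = l)
    (h : ℕ → ℝ → ℝ)
    (hh : ∀ (k : ℕ) (x : ℝ), h k x = Real.exp (-((x - μ k) ^ 2 / (2 * σ k ^ 2))))
    (f : ℝ → ℝ) (hf : ∀ x, f x = ∑ k ∈ Finset.Icc 1 n, γ k * h k x)
    (P : ℕ → ℕ → ℝ → ℝ)
    (hP : ∀ (m k : ℕ) (x : ℝ), P m k x =
      Real.exp ((x - μ k) ^ 2 / (2 * σ k ^ 2)) * iteratedDeriv m (h k) x)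
    (Q : (j : ℕ) → (Fin j → ℕ) → ℝ → ℝ)
    (hQ : ∀ (j : ℕ) (idx : Fin j → ℕ) (x : ℝ),
      Q j idx x = Matrix.det (Matrix.of fun r c : Fin j => P (r : ℕ) (idx c) x))
    (W : ℕ → ℝ → ℝ)
    (hW0 : ∀ x, W 0 x = 1)
    (hW : ∀ j, 1 ≤ j → j ≤ n → ∀ x : ℝ, W j x =
      Matrix.det (Matrix.of fun r c : Fin j => iteratedDeriv (r : ℕ) (h ((c : ℕ) + 1)) x))
    (I : Set ℝ) (hIopen : IsOpen I) (hIconn : I.OrdConnected)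
    (hWne : ∀ i, 1 ≤ i → i ≤ n → ∀ x ∈ I, W i x ≠ 0)
    (ψ : ℕ → ℝ → ℝ)
    (hψ0 : ∀ x ∈ I, ψ 0 x = f x)
    (hψ : ∀ j, 1 ≤ j → j ≤ n → ∀ x ∈ I,
      ψ j x = (W j x / W (j - 1) x) *
        deriv (fun y => (W (j - 1) y / W j y) * ψ (j - 1) y) x)
    (j : ℕ) (hj1 : 1 ≤ j) (hjn : j < n) (x : ℝ) (hx : x ∈ I) :
    ψ j x = ∑ k ∈ Finset.Icc (j + 1) n, γ k *
      (Q (j + 1) (fun c => if (c : ℕ) < j then (c : ℕ) + 1 else k) x /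
        Q j (fun c => (c : ℕ) + 1) x) * h k x := by
  have hs : ∀ k, ContDiff ℝ (⊤ : ℕ∞) (h k) := by
    intro k
    rw [funext (hh k)]
    fun_prop
  have hWlead : ∀ i ≤ n, W i = leadingWronskian h i := by
    intro i hi
    ext y
    rcases Nat.eq_zero_or_pos i with rfl | hi0
    · simp [hW0, leadingWronskian]
    · exact hW i hi0 hi y
  have hne : ∀ i ≤ n, ∀ y ∈ I, leadingWronskian h i y ≠ 0 := by
    intro i hi y hy
    rcases Nat.eq_zero_or_pos i with rfl | hi0
    · simp [leadingWronskian]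
    · rw [← hWlead i hi]
      exact hWne i hi0 hi y hy
  have hmain : ∀ i ≤ n, ∀ y ∈ I, ψ i y =
      ∑ k ∈ Finset.Icc 1 n, γ k * (borderedWronskian h i k y / leadingWronskian h i y) := by
    intro i
    induction i with
    | zero =>
      intro _ y hy
      simp [hψ0 y hy, hf, borderedWronskian, leadingWronskian]
    | succ i ih =>
      intro hi y hy
      have hi' : i ≤ n := by omega
      have heq : (fun z => W i z / W (i + 1) z * ψ i z) =ᶠ[nhds y]
          fun z => ∑ k ∈ Finset.Icc 1 n,
            γ k * (borderedWronskian h i k z / leadingWronskian h (i + 1) z) := by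
        filter_upwards [hIopen.mem_nhds hy] with z hz
        rw [ih hi' z hz, hWlead i hi', hWlead (i + 1) hi, Finset.mul_sum]
        refine Finset.sum_congr rfl fun k _ => ?_
        have := hne i hi' z hz
        field_simp
      have hder := HasDerivAt.fun_sum fun k (_ : k ∈ Finset.Icc 1 n) =>
        (hasDerivAt_borderedWronskian_div h hs i k y (hne i hi' y hy)
          (hne (i + 1) hi y hy)).const_mul (γ k)
      rw [hψ (i + 1) (by omega) hi y hy, Nat.add_sub_cancel, heq.deriv_eq, hder.deriv,
        hWlead i hi', hWlead (i + 1) hi, Finset.mul_sum]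
      refine Finset.sum_congr rfl fun k _ => ?_
      have := hne i hi' y hy
      have := hne (i + 1) hi y hy
      field_simp
  have hPh : ∀ m k, iteratedDeriv m (h k) x = h k x * P m k x := by
    intro m k
    rw [hP, hh k x, ← mul_assoc, ← Real.exp_add]
    simp
  have hQdet : ∀ (m : ℕ) (idx : Fin m → ℕ),
      (Matrix.of fun r c : Fin m => iteratedDeriv (r : ℕ) (h (idx c)) x).det =
        (∏ c, h (idx c) x) * Q m idx x := by
    intro m idx
    rw [hQ, ← Matrix.det_mul_row]
    simp only [hPh, Matrix.of_apply]
  have hh0 : ∀ k, h k x ≠ 0 := by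
    intro k
    rw [hh]
    exact (Real.exp_pos _).ne'
  have hprod : (∏ c : Fin j, h ((c : ℕ) + 1) x) ≠ 0 := Finset.prod_ne_zero_iff.mpr fun c _ => hh0 _
  rw [hmain j hjn.le x hx]
  symm
  refine (Finset.sum_congr rfl fun k _ => ?_).trans
    (Finset.sum_subset (Finset.Icc_subset_Icc_left (by omega : 1 ≤ j + 1)) ?_)
  · rw [borderedWronskian, leadingWronskian, hQdet, hQdet, Fin.prod_univ_castSucc]
    simp only [Fin.val_castSucc, Fin.is_lt, if_true, Fin.val_last, lt_irrefl, if_false]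
    rw [mul_assoc (∏ c : Fin j, h ((c : ℕ) + 1) x), mul_div_mul_left _ _ hprod]
    ring
  · intro k hk hk'
    rw [Finset.mem_Icc] at hk hk'
    rw [borderedWronskian_eq_zero h hk.1 (by omega)]
    simp
end

section
/- Let I ⊂ ℝ be an open interval and let h_1, h_2, f : ℝ → ℝ be twice differentiable on I. Set W_1 = h_1 and W_2 = h_1·h_2' − h_1'·h_2, and assume h_1(x) ≠ 0 and W_2(x) ≠ 0 for all x ∈ I. Then for every x ∈ I, det [[h_1(x), h_2(x), f(x)], [h_1'(x), h_2'(x), f'(x)], [h_1''(x), h_2''(x), f''(x)]] / W_2(x) = (W_2(x)/W_1(x)) · (d/dx)[ (W_1²/W_2) · (d/dx)( f/W_1 ) ](x). -/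
/-- The Polya factorization of the second-order operator
`K₂(f) = W(h₁,h₂,f)/W(h₁,h₂)`: on an open interval where `h₁` and
`W₂ = h₁h₂' − h₁'h₂` do not vanish,
`K₂(f) = (W₂/W₁) · d/dx [ (W₁²/W₂) · d/dx (f/W₁) ]`. -/
theorem polya_factorization_K2
    (I : Set ℝ) (hIopen : IsOpen I) (hIconn : I.OrdConnected)
    (h1 h2 f : ℝ → ℝ)
    (hd1 : ∀ x ∈ I, DifferentiableAt ℝ h1 x)
    (hd1' : ∀ x ∈ I, DifferentiableAt ℝ (deriv h1) x)
    (hd2 : ∀ x ∈ I, DifferentiableAt ℝ h2 x)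
    (hd2' : ∀ x ∈ I, DifferentiableAt ℝ (deriv h2) x)
    (hdf : ∀ x ∈ I, DifferentiableAt ℝ f x)
    (hdf' : ∀ x ∈ I, DifferentiableAt ℝ (deriv f) x)
    (hne1 : ∀ x ∈ I, h1 x ≠ 0)
    (hne2 : ∀ x ∈ I, h1 x * deriv h2 x - deriv h1 x * h2 x ≠ 0)
    (x : ℝ) (hx : x ∈ I) :
    Matrix.det !![h1 x, h2 x, f x;
                  deriv h1 x, deriv h2 x, deriv f x;
                  deriv (deriv h1) x, deriv (deriv h2) x, deriv (deriv f) x] /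
        (h1 x * deriv h2 x - deriv h1 x * h2 x) =
      ((h1 x * deriv h2 x - deriv h1 x * h2 x) / h1 x) *
        deriv (fun y =>
          (h1 y ^ 2 / (h1 y * deriv h2 y - deriv h1 y * h2 y)) *
            deriv (fun z => f z / h1 z) y) x := by
  have hev : (fun y => (h1 y ^ 2 / (h1 y * deriv h2 y - deriv h1 y * h2 y)) *
      deriv (fun z => f z / h1 z) y) =ᶠ[nhds x]
      fun y => (h1 y * deriv f y - deriv h1 y * f y) /
        (h1 y * deriv h2 y - deriv h1 y * h2 y) := by
    filter_upwards [hIopen.mem_nhds hx] with y hy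
    have h := hne1 y hy
    have hw := hne2 y hy
    rw [((hdf y hy).hasDerivAt.fun_div (hd1 y hy).hasDerivAt h).deriv]
    rw [div_mul_div_comm, mul_comm (_ - _) (h1 y ^ 2),
      mul_div_mul_left _ _ (pow_ne_zero 2 h)]
    ring
  have hwronskian {g : ℝ → ℝ} (hg : DifferentiableAt ℝ g x)
      (hg' : DifferentiableAt ℝ (deriv g) x) :
      HasDerivAt (fun y => h1 y * deriv g y - deriv h1 y * g y)
        (h1 x * deriv (deriv g) x - deriv (deriv h1) x * g x) x := by
    refine (((hd1 x hx).hasDerivAt.fun_mul hg'.hasDerivAt).fun_sub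
      ((hd1' x hx).hasDerivAt.fun_mul hg.hasDerivAt)).congr_deriv ?_
    ring
  have h := hne1 x hx
  have hw := hne2 x hx
  rw [hev.deriv_eq, ((hwronskian (hdf x hx) (hdf' x hx)).fun_div
    (hwronskian (hd2 x hx) (hd2' x hx)) hw).deriv, Matrix.det_fin_three]
  simp only [Matrix.of_apply, Matrix.cons_val]
  generalize hW : h1 x * deriv h2 x - deriv h1 x * h2 x = W at hw ⊢
  field_simp
  rw [← hW]
  ring
end

section
/- Let θ, ρ ∈ ℝ with θ² < ρ², set ω = √(ρ² − θ²), and let f : ℝ → ℝ be twice differentiable on an open interval I on which sin(ωx) ≠ 0. Then for every x ∈ I, (e^{θx}/sin(ωx)) · (d/dx)[ sin²(ωx) · (d/dx)( f(x)·e^{−θx}/sin(ωx) ) ](x) = f''(x) − 2θ f'(x) + ρ² f(x). -/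
theorem hasDerivAt_sin_const_mul (ω x : ℝ) :
    HasDerivAt (fun y => Real.sin (ω * y)) (ω * Real.cos (ω * x)) x := by
  simpa [mul_comm] using ((hasDerivAt_id x).const_mul ω).sin

theorem hasDerivAt_cos_const_mul (ω x : ℝ) :
    HasDerivAt (fun y => Real.cos (ω * y)) (-(ω * Real.sin (ω * x))) x := by
  simpa [mul_comm] using ((hasDerivAt_id x).const_mul ω).cos

theorem hasDerivAt_exp_const_mul (a x : ℝ) :
    HasDerivAt (fun y => Real.exp (a * y)) (a * Real.exp (a * x)) x := by
  simpa [mul_comm] using ((hasDerivAt_id x).const_mul a).exp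

/-- The inner first-order operation, cleared of its denominator. -/
theorem sin_sq_mul_deriv_mul_exp_div_sin {θ ω y : ℝ} {f : ℝ → ℝ}
    (hs : Real.sin (ω * y) ≠ 0) (hf : DifferentiableAt ℝ f y) :
    Real.sin (ω * y) ^ 2 *
        deriv (fun z => f z * Real.exp (-θ * z) / Real.sin (ω * z)) y =
      Real.exp (-θ * y) *
        ((deriv f y - θ * f y) * Real.sin (ω * y) - f y * (ω * Real.cos (ω * y))) := by
  have h := (hf.hasDerivAt.mul (hasDerivAt_exp_const_mul (-θ) y)).div
    (hasDerivAt_sin_const_mul ω y) hs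
  have h' : deriv (fun z => f z * Real.exp (-θ * z) / Real.sin (ω * z)) y = _ := h.deriv
  rw [h', mul_div_cancel₀ _ (pow_ne_zero 2 hs)]
  simp only [Pi.mul_apply]
  ring

/-- The derivative of the cleared inner operation is `e^{-θx} sin(ωx)` times the
second-order operator with roots `θ ± iω`. -/
theorem hasDerivAt_exp_mul_sub_sin_cos {θ ω x : ℝ} {f : ℝ → ℝ}
    (hf : DifferentiableAt ℝ f x) (hf' : DifferentiableAt ℝ (deriv f) x) :
    HasDerivAt (fun y => Real.exp (-θ * y) *
        ((deriv f y - θ * f y) * Real.sin (ω * y) - f y * (ω * Real.cos (ω * y))))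
      (Real.exp (-θ * x) * Real.sin (ω * x) *
        (deriv (deriv f) x - 2 * θ * deriv f x + (θ ^ 2 + ω ^ 2) * f x)) x := by
  have h := (hasDerivAt_exp_const_mul (-θ) x).mul
    (((hf'.hasDerivAt.sub (hf.hasDerivAt.const_mul θ)).mul (hasDerivAt_sin_const_mul ω x)).sub
      (hf.hasDerivAt.mul ((hasDerivAt_cos_const_mul ω x).const_mul ω)))
  refine h.congr_deriv ?_
  simp only [Pi.mul_apply, Pi.sub_apply]
  ring

/-- The factorized form of the irreducible second-order operator
`p(D) = D² − 2θD + ρ²`: with `ω = √(ρ²−θ²)`, on an open interval where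
`sin(ωx) ≠ 0` and `f` is twice differentiable,
`(e^{θx}/sin(ωx)) · d/dx[ sin²(ωx) · d/dx( f e^{−θx}/sin(ωx) ) ] = f'' − 2θf' + ρ²f`. -/
theorem ept_quadratic_factorization
    (θ ρ : ℝ) (hθρ : θ ^ 2 < ρ ^ 2)
    (f : ℝ → ℝ) (I : Set ℝ) (hIopen : IsOpen I) (hIconn : I.OrdConnected)
    (hsin : ∀ x ∈ I, Real.sin (Real.sqrt (ρ ^ 2 - θ ^ 2) * x) ≠ 0)
    (hdf : ∀ x ∈ I, DifferentiableAt ℝ f x)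
    (hdf' : ∀ x ∈ I, DifferentiableAt ℝ (deriv f) x)
    (x : ℝ) (hx : x ∈ I) :
    (Real.exp (θ * x) / Real.sin (Real.sqrt (ρ ^ 2 - θ ^ 2) * x)) *
        deriv (fun y => Real.sin (Real.sqrt (ρ ^ 2 - θ ^ 2) * y) ^ 2 *
          deriv (fun z =>
            f z * Real.exp (-θ * z) / Real.sin (Real.sqrt (ρ ^ 2 - θ ^ 2) * z)) y) x =
      deriv (deriv f) x - 2 * θ * deriv f x + ρ ^ 2 * f x := by
  have hω : Real.sqrt (ρ ^ 2 - θ ^ 2) ^ 2 = ρ ^ 2 - θ ^ 2 := Real.sq_sqrt (by linarith)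
  have hs := hsin x hx
  generalize Real.sqrt (ρ ^ 2 - θ ^ 2) = ω at *
  have heq : (fun y => Real.sin (ω * y) ^ 2 *
      deriv (fun z => f z * Real.exp (-θ * z) / Real.sin (ω * z)) y) =ᶠ[nhds x]
      fun y => Real.exp (-θ * y) *
        ((deriv f y - θ * f y) * Real.sin (ω * y) - f y * (ω * Real.cos (ω * y))) := by
    filter_upwards [hIopen.mem_nhds hx] with y hy
    exact sin_sq_mul_deriv_mul_exp_div_sin (hsin y hy) (hdf y hy)
  rw [heq.deriv_eq, (hasDerivAt_exp_mul_sub_sin_cos (hdf x hx) (hdf' x hx)).deriv, hω,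
    neg_mul, Real.exp_neg]
  generalize Real.sin (ω * x) = s at hs ⊢
  field_simp
  ring
end

section
/- Let R be a commutative ring, let n ≥ 2, and let M be an n×n matrix over R. Denote by M̃ the (n−2)×(n−2) matrix obtained from M by deleting the last two rows and the last two columns; by A' the matrix obtained by deleting row n and column n; by B' the matrix obtained by deleting row n and column n−1; by C' the matrix obtained by deleting row n−1 and column n; and by D' the matrix obtained by deleting row n−1 and column n−1. Then det(M) · det(M̃) = det(A') · det(D') − det(B') · det(C'). -/
namespace Matrix

variable {m n R : Type*} [Fintype m] [Fintype n] [DecidableEq m] [DecidableEq n] [CommRing R]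

theorem det_mul_det_toBlocks₂₂_adjugate (A : Matrix (m ⊕ n) (m ⊕ n) R) :
    A.det * A.adjugate.toBlocks₂₂.det = A.toBlocks₁₁.det * A.det ^ Fintype.card n := by
  have h : A * A.adjugate = A.det • 1 := A.mul_adjugate
  have h₁₂ := congrArg toBlocks₁₂ h
  have h₂₂ := congrArg toBlocks₂₂ h
  rw [← fromBlocks_toBlocks A, ← fromBlocks_toBlocks (adjugate _), fromBlocks_multiply,
    ← fromBlocks_one, fromBlocks_smul, fromBlocks_toBlocks] at h₁₂ h₂₂
  simp only [toBlocks_fromBlocks₁₂, toBlocks_fromBlocks₂₂, smul_zero] at h₁₂ h₂₂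
  have key : A * fromBlocks 1 A.adjugate.toBlocks₁₂ 0 A.adjugate.toBlocks₂₂ =
      fromBlocks A.toBlocks₁₁ 0 A.toBlocks₂₁ (A.det • 1) := by
    conv_lhs => rw [← fromBlocks_toBlocks A]
    rw [fromBlocks_multiply, fromBlocks_toBlocks, h₁₂, h₂₂]
    simp
  have hdet := congrArg det key
  rwa [det_mul, det_fromBlocks_zero₂₁, det_fromBlocks_zero₁₂, det_one, one_mul, det_smul,
    det_one, mul_one] at hdet

/-- **Jacobi's complementary minor formula** for the trailing principal block of the adjugate. -/
theorem det_toBlocks₂₂_adjugate [Nonempty n] (A : Matrix (m ⊕ n) (m ⊕ n) R) :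
    A.adjugate.toBlocks₂₂.det = A.det ^ (Fintype.card n - 1) * A.toBlocks₁₁.det := by
  let X := mvPolynomialX (m ⊕ n) (m ⊕ n) ℤ
  suffices h : X.adjugate.toBlocks₂₂.det = X.det ^ (Fintype.card n - 1) * X.toBlocks₁₁.det by
    let f := (MvPolynomial.aeval (R := ℤ) fun p : (m ⊕ n) × (m ⊕ n) => A p.1 p.2)
    have hX : f.mapMatrix X = A := mvPolynomialX_mapMatrix_aeval ℤ A
    have hadj : f.mapMatrix X.adjugate.toBlocks₂₂ = A.adjugate.toBlocks₂₂ := by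
      rw [← hX, ← AlgHom.map_adjugate]; rfl
    have hblock : f.mapMatrix X.toBlocks₁₁ = A.toBlocks₁₁ := by
      rw [← hX]; rfl
    have hf := congrArg f h
    rwa [map_mul, map_pow, AlgHom.map_det, AlgHom.map_det, AlgHom.map_det, hX, hadj, hblock] at hf
  apply mul_left_cancel₀ (show X.det ≠ 0 from det_mvPolynomialX_ne_zero _ ℤ)
  rw [det_mul_det_toBlocks₂₂_adjugate, ← mul_assoc, mul_pow_sub_one Fintype.card_ne_zero, mul_comm]

end Matrix


/-- The Desnanot–Jacobi (bordered matrix) determinant identity: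
`det M · det M̃ = det A' · det D' − det B' · det C'`, where `M̃` removes the last
two rows and columns, and `A', B', C', D'` remove one of the last two rows and one
of the last two columns as indicated. -/
theorem desnanot_jacobi_bordered
    {R : Type*} [CommRing R] (m : ℕ) (M : Matrix (Fin (m + 2)) (Fin (m + 2)) R) :
    M.det * (M.submatrix (fun i : Fin m => i.castSucc.castSucc)
        (fun i : Fin m => i.castSucc.castSucc)).det =
      (M.submatrix Fin.castSucc Fin.castSucc).det *
          (M.submatrix (Fin.succAbove ⟨m, by omega⟩)
            (Fin.succAbove ⟨m, by omega⟩)).det -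
        (M.submatrix Fin.castSucc (Fin.succAbove ⟨m, by omega⟩)).det *
          (M.submatrix (Fin.succAbove ⟨m, by omega⟩) Fin.castSucc).det := by
  have h := (M.submatrix finSumFinEquiv finSumFinEquiv :
    Matrix (Fin m ⊕ Fin 2) (Fin m ⊕ Fin 2) R).det_toBlocks₂₂_adjugate
  have hblock : (M.submatrix finSumFinEquiv finSumFinEquiv :
      Matrix (Fin m ⊕ Fin 2) (Fin m ⊕ Fin 2) R).toBlocks₁₁ =
      M.submatrix (fun i : Fin m => i.castSucc.castSucc) fun i : Fin m => i.castSucc.castSucc :=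
    rfl
  have h₀ : (finSumFinEquiv (Sum.inr 0) : Fin (m + 2)) = ⟨m, by omega⟩ := rfl
  have h₁ : (finSumFinEquiv (Sum.inr 1) : Fin (m + 2)) = Fin.last (m + 1) := rfl
  rw [Matrix.adjugate_submatrix_equiv_self, Matrix.det_submatrix_equiv_self, hblock,
    Fintype.card_fin, pow_one, Matrix.det_fin_two] at h
  simp only [Matrix.toBlocks₂₂, Matrix.of_apply, Matrix.submatrix_apply, h₀, h₁,
    Matrix.adjugate_fin_succ_eq_det_submatrix, Fin.succAbove_last, Fin.val_last] at h
  rw [Even.neg_one_pow ⟨m, rfl⟩, Even.neg_one_pow ⟨m + 1, rfl⟩,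
    Odd.neg_one_pow (n := m + 1 + m) ⟨m, by ring⟩,
    Odd.neg_one_pow (n := m + (m + 1)) ⟨m, by ring⟩] at h
  linear_combination -h
end
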